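/- For every integer N ≥ 1 and every real x with |x| ≤ √(N + 1/2), |C(x) − C_N(x)| ≤ √π · c̃_N · |x| · e^{-πN}/(2N + 1) and |S(x) − S_N(x)| ≤ √π · c̃_N · |x| · e^{-πN}/(2N + 1). -/

import Mathlib

noncomputable section

/-- Fresnel cosine integral `C(x) = ∫_0^x cos(πt²/2) dt`. -/
def C (x : ℝ) : ℝ := ∫ t in (0 : ℝ)..x, Real.cos (Real.pi * t ^ 2 / 2)

/-- Fresnel sine integral `S(x) = ∫_0^x sin(πt²/2) dt`. -/
def S (x : ℝ) : ℝ := ∫ t in (0 : ℝ)..x, Real.sin (Real.pi * t ^ 2 / 2)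

/-- `A_N = √((N + 1/2)π)`. -/
def A (N : ℕ) : ℝ := Real.sqrt (((N : ℝ) + 1 / 2) * Real.pi)

/-- `t_k = (k − 1/2)π/√((N + 1/2)π)`. -/
def tk (N k : ℕ) : ℝ := (((k : ℝ) - 1 / 2) * Real.pi) / Real.sqrt (((N : ℝ) + 1 / 2) * Real.pi)

/-- `a_N(s) = s·Σ_{k=1}^N e^{-t_k²}/(s² + t_k⁴)`. -/
def aN (N : ℕ) (s : ℝ) : ℝ :=
  s * ∑ k ∈ Finset.Icc 1 N, Real.exp (-(tk N k) ^ 2) / (s ^ 2 + (tk N k) ^ 4)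

/-- `b_N(s) = Σ_{k=1}^N t_k²·e^{-t_k²}/(s² + t_k⁴)`. -/
def bN (N : ℕ) (s : ℝ) : ℝ :=
  ∑ k ∈ Finset.Icc 1 N, (tk N k) ^ 2 * Real.exp (-(tk N k) ^ 2) / (s ^ 2 + (tk N k) ^ 4)

/-- The approximation `C_N(x)` to the Fresnel cosine integral. -/
def CN (N : ℕ) (x : ℝ) : ℝ :=
  1 / 2 * ((Real.sinh (Real.sqrt Real.pi * A N * x) + Real.sin (Real.sqrt Real.pi * A N * x)) /
      (Real.cos (Real.sqrt Real.pi * A N * x) + Real.cosh (Real.sqrt Real.pi * A N * x))) +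
    Real.sqrt Real.pi * x / A N *
      (aN N (Real.pi / 2 * x ^ 2) * Real.sin (Real.pi / 2 * x ^ 2) -
        bN N (Real.pi / 2 * x ^ 2) * Real.cos (Real.pi / 2 * x ^ 2))

/-- The approximation `S_N(x)` to the Fresnel sine integral. -/
def SN (N : ℕ) (x : ℝ) : ℝ :=
  1 / 2 * ((Real.sinh (Real.sqrt Real.pi * A N * x) - Real.sin (Real.sqrt Real.pi * A N * x)) /
      (Real.cos (Real.sqrt Real.pi * A N * x) + Real.cosh (Real.sqrt Real.pi * A N * x))) -
    Real.sqrt Real.pi * x / A N *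
      (aN N (Real.pi / 2 * x ^ 2) * Real.cos (Real.pi / 2 * x ^ 2) +
        bN N (Real.pi / 2 * x ^ 2) * Real.sin (Real.pi / 2 * x ^ 2))

/-- `β = 1 − √2/2 − (2√2 + 1)/16`. -/
def β : ℝ := 1 - Real.sqrt 2 / 2 - (2 * Real.sqrt 2 + 1) / 16

/-- The constant `c_N`. -/
def c (N : ℕ) : ℝ :=
  20 * Real.sqrt 2 * Real.exp (-Real.pi / 2) /
      (9 * Real.pi * (1 - Real.exp (-2 * A N ^ 2))) *
      (1 + 2 * Real.sqrt Real.pi * Real.exp (-β * A N ^ 2)) +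
    (2 * Real.pi + 1) * Real.exp (-Real.pi / 2) /
      (2 * Real.sqrt 2 * (Real.pi * Real.sqrt Real.pi) * A N)

/-- The constant `c̃_N`. -/
def ctilde (N : ℕ) : ℝ :=
  8 / (3 * (Real.pi * Real.sqrt Real.pi) * Real.exp (Real.pi / 2) *
      (1 - Real.exp (-2 * A N ^ 2))) +
    (2 * Real.pi + 1) / (Real.pi ^ 2 * Real.exp (Real.pi / 2) * A N)

open Complex Filter Topology in
/-- Mittag-Leffler expansion of the hyperbolic tangent, off the imaginary axis. -/
theorem tendsto_sum_tanh {y : ℂ} (hy : y.re ≠ 0) :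
    Tendsto (fun n : ℕ => ∑ k ∈ Finset.range n, 2 * y / (((k + 1 / 2) * Real.pi : ℂ) ^ 2 + y ^ 2))
      atTop (𝓝 (tanh y)) := by
  have hpi : (Real.pi : ℂ) ≠ 0 := ofReal_ne_zero.2 Real.pi_ne_zero
  set w : ℂ := I * y / Real.pi with hw
  have him : w.im ≠ 0 := by
    have : w.im = y.re / Real.pi := by simp [hw, Complex.div_ofReal_im]
    rw [this]; exact div_ne_zero hy Real.pi_ne_zero
  have hne : ∀ r : ℝ, w + r ≠ 0 := fun r h => him (by simpa using congrArg Complex.im h)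
  have hz : (1 / 2 + w : ℂ) ∈ integerComplement := by
    rw [mem_integerComplement_iff]
    rintro ⟨n, hn⟩
    exact him (by simpa using (congrArg Complex.im hn).symm)
  have hpartial : ∀ n : ℕ,
      ∑ k ∈ Finset.range n, 2 * y / (((k + 1 / 2) * Real.pi : ℂ) ^ 2 + y ^ 2) =
        I / Real.pi * (∑ k ∈ Finset.range n, cotTerm (1 / 2 + w) k + 1 / (1 / 2 + w)
          - 1 / (w + n + 1 / 2)) := by
    intro n
    induction n with
    | zero => simp [add_comm]
    | succ n ih =>
      rw [Finset.sum_range_succ, ih, Finset.sum_range_succ, cotTerm]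
      have h1 : w + n + 1 / 2 ≠ 0 := by simpa [add_assoc] using hne (n + 1 / 2)
      have h2 : w + (n + 1 : ℕ) + 1 / 2 ≠ 0 := by simpa [add_assoc] using hne (n + 1 + 1 / 2)
      have h3 : w - n - 1 / 2 ≠ 0 := by
        have := hne (-n - 1 / 2)
        push_cast at this
        rwa [show w - n - 1 / 2 = w + (-n - 1 / 2) by ring]
      have hy' : y = -I * Real.pi * w := by
        rw [hw]; field_simp; simp
      have h4 : ((n + 1 / 2) * Real.pi : ℂ) ^ 2 + y ^ 2 =
          -Real.pi ^ 2 * (w + n + 1 / 2) * (w - n - 1 / 2) := by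
        rw [hy']; ring_nf; rw [I_sq]; ring
      have e1 : 1 / 2 + w - ((n : ℂ) + 1) = w - n - 1 / 2 := by ring
      have e2 : 1 / 2 + w + ((n : ℂ) + 1) = w + (n + 1 : ℕ) + 1 / 2 := by push_cast; ring
      rw [h4, e1, e2]
      have key : 2 * y / (-Real.pi ^ 2 * (w + n + 1 / 2) * (w - n - 1 / 2)) =
          I / Real.pi * (1 / (w - n - 1 / 2) + 1 / (w + n + 1 / 2)) := by
        rw [hy', div_add_div _ _ h3 h1, div_mul_div_comm, div_eq_div_iff]
        · ring
        · exact mul_ne_zero (mul_ne_zero (neg_ne_zero.2 (pow_ne_zero 2 hpi)) h1) h3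
        · exact mul_ne_zero hpi (mul_ne_zero h3 h1)
      rw [key]
      ring
  have hlim : Tendsto (fun n : ℕ => 1 / (w + n + 1 / 2)) atTop (𝓝 0) := by
    simp_rw [one_div]
    refine Filter.tendsto_inv₀_cobounded.comp ?_
    have := (tendsto_add_const_cobounded (w + 2⁻¹)).comp
      (tendsto_natCast_atTop_cobounded (α := ℂ))
    refine this.congr fun n => ?_
    simp only [Function.comp_apply]
    ring
  have hcot : Real.pi * cot (Real.pi * (1 / 2 + w)) = - Real.pi * I * tanh y := by
    have e : (Real.pi : ℂ) * (1 / 2 + w) = y * I + Real.pi / 2 := by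
      rw [hw]; field_simp; ring
    rw [e, cot, cos_add_pi_div_two, sin_add_pi_div_two, neg_div, ← tan_eq_sin_div_cos, tan_mul_I]
    ring
  have := (((tendsto_logDeriv_euler_cot_sub hz).add_const (1 / (1 / 2 + w))).sub hlim).const_mul
    (I / Real.pi)
  simp_rw [hpartial]
  convert this using 2
  rw [sub_add_cancel, sub_zero, hcot]
  field_simp; simp

open Complex in
/-- Poisson summation for a Gaussian sampled at the half-integers. -/
theorem Complex.tsum_gaussian_half_int {a : ℝ} (ha : 0 < a) :
    ∑' n : ℤ, cexp (-Real.pi * a * n ^ 2 - Real.pi * I * n) =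
      1 / Real.sqrt a * ∑' n : ℤ, Real.exp (-Real.pi / a * (n + 1 / 2) ^ 2) := by
  have h := Complex.tsum_exp_neg_quadratic (a := a) (by simpa using ha) (-(I / 2))
  have e1 : (a : ℂ) ^ (1 / 2 : ℂ) = Real.sqrt a := by
    rw [Real.sqrt_eq_rpow, ofReal_cpow ha.le]; norm_num
  rw [e1] at h
  rw [ofReal_tsum]
  convert h using 4 with n n
  · ring
  · push_cast
    congr 3
    ring_nf; rw [I_sq]; ring

theorem summable_gaussian_nat {b : ℝ} (hb : 0 < b) :
    Summable fun k : ℕ => Real.exp (-b * ((k : ℝ) + 1 / 2) ^ 2) :=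
  Real.summable_exp_nat_mul_of_ge (neg_neg_of_pos hb) (f := fun k => ((k : ℝ) + 1 / 2) ^ 2)
    fun i => by nlinarith [sq_nonneg (i : ℝ)]

theorem tsum_gaussian_half_int_eq {b : ℝ} (hb : 0 < b) :
    ∑' n : ℤ, Real.exp (-b * ((n : ℝ) + 1 / 2) ^ 2) =
      2 * ∑' k : ℕ, Real.exp (-b * ((k : ℝ) + 1 / 2) ^ 2) := by
  have e : ∀ n : ℕ, Real.exp (-b * (((-((n : ℤ) + 1) : ℤ) : ℝ) + 1 / 2) ^ 2) =
      Real.exp (-b * ((n : ℝ) + 1 / 2) ^ 2) := fun n => by push_cast; ring_nf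
  rw [tsum_of_nat_of_neg_add_one]
  · simp_rw [e, Int.cast_natCast]; ring
  · simpa using summable_gaussian_nat hb
  · simpa only [e] using summable_gaussian_nat hb

open Complex in
/-- The midpoint rule for a Gaussian is exponentially accurate. -/
theorem abs_midpoint_gaussian_sub_one_le {a : ℝ} (ha : 0 < a)
    (hq : Real.exp (-Real.pi * a) ≤ 1 / 4) :
    |2 / Real.sqrt a * ∑' k : ℕ, Real.exp (-Real.pi / a * ((k : ℝ) + 1 / 2) ^ 2) - 1| ≤
      8 / 3 * Real.exp (-Real.pi * a) := by
  set q := Real.exp (-Real.pi * a) with hqdef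
  have hq0 : 0 < q := Real.exp_pos _
  set f : ℤ → ℂ := fun n => cexp (-Real.pi * a * n ^ 2 - Real.pi * I * n) with hf
  have hgeom : HasSum (fun n : ℕ => q * q ^ n) (q * (1 - q)⁻¹) :=
    (hasSum_geometric_of_lt_one hq0.le (by linarith)).mul_left q
  have hbound : ∀ m : ℤ, ∀ n : ℕ, ((m : ℝ)) ^ 2 = (n + 1) ^ 2 → ‖f m‖ ≤ q * q ^ n := by
    intro m n hmn
    rw [hf, norm_exp, ← pow_succ', hqdef, ← Real.exp_nat_mul, Real.exp_le_exp]
    have : (-Real.pi * a * m ^ 2 - Real.pi * I * m : ℂ).re = -Real.pi * a * (m : ℝ) ^ 2 := by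
      simp [pow_two]
    rw [this, hmn]
    push_cast
    have : 0 < Real.pi * a := by positivity
    nlinarith [mul_nonneg this.le (by positivity : (0 : ℝ) ≤ n * (n + 1))]
  have hb1 : ∀ n : ℕ, ‖f (n + 1)‖ ≤ q * q ^ n := fun n => hbound _ n (by push_cast; ring)
  have hb2 : ∀ n : ℕ, ‖f (-(n + 1))‖ ≤ q * q ^ n := fun n => hbound _ n (by push_cast; ring)
  have h := Complex.tsum_gaussian_half_int ha
  rw [← hf] at h
  simp_rw [neg_div] at h ⊢
  rw [tsum_gaussian_half_int_eq (by positivity),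
    tsum_of_add_one_of_neg_add_one (.of_norm_bounded hgeom.summable hb1)
      (.of_norm_bounded hgeom.summable hb2)] at h
  have hf0 : f 0 = 1 := by simp [hf]
  have hcast : ((2 / Real.sqrt a * ∑' k : ℕ, Real.exp (-(Real.pi / a) * ((k : ℝ) + 1 / 2) ^ 2) - 1
      : ℝ) : ℂ) = ∑' n : ℕ, f (n + 1) + ∑' n : ℕ, f (-(n + 1)) := by
    rw [hf0] at h
    push_cast at h ⊢
    linear_combination -h
  rw [← Real.norm_eq_abs, ← norm_real, hcast]
  have hfrac : q * (1 - q)⁻¹ ≤ 4 / 3 * q := by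
    rw [← div_eq_mul_inv, div_le_iff₀ (by linarith)]
    nlinarith
  calc _ ≤ _ := norm_add_le _ _
    _ ≤ q * (1 - q)⁻¹ + q * (1 - q)⁻¹ :=
      add_le_add (tsum_of_norm_bounded hgeom hb1) (tsum_of_norm_bounded hgeom hb2)
    _ ≤ _ := by linarith

theorem integral_two_mul_mul_cexp_neg_sq {l : ℂ} (hl : l ≠ 0) :
    ∫ u in (0 : ℝ)..1, 2 * (u : ℂ) * Complex.exp (-l * u ^ 2) = (1 - Complex.exp (-l)) / l := by
  have hderiv : ∀ u ∈ Set.uIcc (0 : ℝ) 1,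
      HasDerivAt (fun u : ℝ => -Complex.exp (-l * (u : ℂ) ^ 2) / l)
        (2 * (u : ℂ) * Complex.exp (-l * u ^ 2)) u := by
    intro u _
    have h : HasDerivAt (fun z : ℂ => -Complex.exp (-l * z ^ 2) / l)
        (2 * (u : ℂ) * Complex.exp (-l * u ^ 2)) u := by
      convert! ((((hasDerivAt_pow 2 (u : ℂ)).const_mul (-l)).cexp).neg.div_const l) using 1
      field_simp
      simp
    exact h.comp_ofReal
  rw [intervalIntegral.integral_eq_sub_of_hasDerivAt hderiv
    (Continuous.intervalIntegrable (by fun_prop) _ _)]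
  simp
  ring

theorem integral_two_mul_mul_exp_neg_sq_le {r : ℝ} (hr : 0 < r) :
    ∫ u in (0 : ℝ)..1, 2 * u * Real.exp (-r * u ^ 2) ≤ 1 / r := by
  have h := integral_two_mul_mul_cexp_neg_sq (l := r) (Complex.ofReal_ne_zero.2 hr.ne')
  have h' : ∫ u in (0 : ℝ)..1, 2 * u * Real.exp (-r * u ^ 2) = (1 - Real.exp (-r)) / r := by
    rw [← Complex.ofReal_inj, ← intervalIntegral.integral_ofReal]
    push_cast
    exact h
  rw [h']
  have := Real.exp_pos (-r)
  gcongr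
  linarith

theorem integral_exp_neg_sq_mul_le {r : ℝ} (hr : 0 < r) :
    ∫ u in (0 : ℝ)..1, Real.exp (-r * (3 - 2 * u)) ≤ Real.exp (-r) / (2 * r) := by
  have hderiv : ∀ u ∈ Set.uIcc (0 : ℝ) 1,
      HasDerivAt (fun u : ℝ => Real.exp (-r * (3 - 2 * u)) / (2 * r))
        (Real.exp (-r * (3 - 2 * u))) u := by
    intro u _
    convert! ((((hasDerivAt_id u).const_mul 2).const_sub 3).const_mul (-r)).exp.div_const (2 * r)
      using 1
    simp; field_simp
  rw [intervalIntegral.integral_eq_sub_of_hasDerivAt hderiv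
    (Continuous.intervalIntegrable (by fun_prop) _ _)]
  have : 0 ≤ Real.exp (-r * (3 - 2 * 0)) / (2 * r) := by positivity
  norm_num at this ⊢
  exact this

theorem summable_one_div_nat_add_half_sq :
    Summable fun k : ℕ => 1 / ((k : ℝ) + 1 / 2) ^ 2 := by
  have h : Summable fun k : ℕ => 4 * (1 / (((k + 1 : ℕ) : ℝ)) ^ 2) :=
    ((summable_nat_add_iff 1).2 (Real.summable_one_div_nat_pow.2 one_lt_two)).mul_left 4
  refine h.of_nonneg_of_le (fun k => by positivity) fun k => ?_
  rw [mul_one_div, div_le_div_iff₀ (by positivity) (by positivity)]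
  push_cast
  nlinarith [(Nat.cast_nonneg k : (0 : ℝ) ≤ k), sq_nonneg (k : ℝ)]

/-- The node `(k + 1/2) π / α` of the midpoint rule with step `π / α`. -/
def midpointNode (α : ℝ) (k : ℕ) : ℝ := (k + 1 / 2) * Real.pi / α

theorem midpointNode_pos {α : ℝ} (hα : 0 < α) (k : ℕ) : 0 < midpointNode α k := by
  have := Real.pi_pos
  unfold midpointNode; positivity

theorem summable_one_div_midpointNode_sq (α : ℝ) :
    Summable fun k : ℕ => 1 / midpointNode α k ^ 2 := by
  refine (summable_one_div_nat_add_half_sq.mul_left ((α / Real.pi) ^ 2)).congr fun k => ?_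
  simp only [midpointNode, div_pow, mul_pow, one_div_div]
  rw [div_mul_div_comm, mul_one, mul_comm (Real.pi ^ 2)]

theorem sq_le_norm_sq_sub_mul_I (t s : ℝ) : t ^ 2 ≤ ‖(t : ℂ) ^ 2 - s * Complex.I‖ := by
  have h := Complex.abs_re_le_norm ((t : ℂ) ^ 2 - s * Complex.I)
  have : ((t : ℂ) ^ 2 - s * Complex.I).re = t ^ 2 := by simp [← Complex.ofReal_pow]
  rwa [this, abs_of_nonneg (sq_nonneg t)] at h

theorem midpointNode_sq_sub_mul_I_ne_zero {α : ℝ} (hα : 0 < α) (s : ℝ) (k : ℕ) :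
    (midpointNode α k : ℂ) ^ 2 - s * Complex.I ≠ 0 :=
  norm_pos_iff.1 ((pow_pos (midpointNode_pos hα k) 2).trans_le (sq_le_norm_sq_sub_mul_I _ s))

/-- Midpoint rule error for the density of the complex Fresnel integral. -/
theorem abs_midpoint_theta_sub_le {α u : ℝ} (hα : 2 ≤ α) (hu : 0 < u) (hu1 : u ≤ 1) :
    |Real.pi / α * (2 * u * ∑' k : ℕ, Real.exp (-(midpointNode α k ^ 2 * u ^ 2))) -
        Real.sqrt Real.pi| ≤
      Real.sqrt Real.pi * (8 / 3 * Real.exp (-α ^ 2 * (3 - 2 * u))) := by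
  have hα0 : 0 < α := by linarith
  have hpi := Real.pi_pos
  have hsp : 0 < Real.sqrt Real.pi := Real.sqrt_pos.2 hpi
  set a : ℝ := (α / (Real.sqrt Real.pi * u)) ^ 2 with ha
  have ha0 : 0 < a := by positivity
  have hsqrt : Real.sqrt a = α / (Real.sqrt Real.pi * u) := Real.sqrt_sq (by positivity)
  have hae : Real.pi * a = α ^ 2 / u ^ 2 := by
    rw [ha, div_pow, mul_pow, Real.sq_sqrt hpi.le]; field_simp
  have hle : α ^ 2 * (3 - 2 * u) ≤ Real.pi * a := by
    rw [hae, le_div_iff₀ (by positivity), mul_assoc]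
    have : (3 - 2 * u) * u ^ 2 ≤ 1 := by
      nlinarith [sq_nonneg (1 - u), mul_nonneg (sq_nonneg (1 - u)) hu.le]
    nlinarith [sq_nonneg α]
  have hq : Real.exp (-Real.pi * a) ≤ 1 / 4 := by
    have h4 : 4 ≤ Real.pi * a := by nlinarith [sq_nonneg α]
    have h5 := Real.add_one_le_exp (Real.pi * a)
    rw [neg_mul, Real.exp_neg, one_div]
    exact inv_anti₀ (by norm_num) (by linarith)
  have h := abs_midpoint_gaussian_sub_one_le ha0 hq
  have hterm : ∀ k : ℕ, Real.exp (-(midpointNode α k ^ 2 * u ^ 2)) =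
      Real.exp (-Real.pi / a * ((k : ℝ) + 1 / 2) ^ 2) := by
    intro k
    congr 1
    rw [midpointNode, ha, div_pow, div_pow, mul_pow, mul_pow, Real.sq_sqrt hpi.le]
    field_simp
  simp_rw [hterm]
  rw [hsqrt] at h
  set T := ∑' k : ℕ, Real.exp (-Real.pi / a * ((k : ℝ) + 1 / 2) ^ 2)
  have e : Real.pi / α * (2 * u * T) - Real.sqrt Real.pi =
      Real.sqrt Real.pi * (2 / (α / (Real.sqrt Real.pi * u)) * T - 1) := by
    field_simp
    linear_combination (-2 * u * T) * Real.sq_sqrt hpi.le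
  rw [e, abs_mul, abs_of_pos hsp]
  gcongr
  refine h.trans ?_
  have : -Real.pi * a ≤ -α ^ 2 * (3 - 2 * u) := by linarith
  gcongr

open Complex MeasureTheory in
/-- The midpoint rule approximation to `√π ∫_0^1 exp (i s u²) du`. -/
theorem exists_hasSum_midpoint_fresnel {α : ℝ} (hα : 2 ≤ α) (s : ℝ) :
    ∃ T : ℂ, HasSum (fun k : ℕ => (1 - cexp (-((midpointNode α k : ℂ) ^ 2 - s * I))) /
        ((midpointNode α k : ℂ) ^ 2 - s * I)) T ∧
      ‖Real.pi / α * T - Real.sqrt Real.pi * ∫ u in (0 : ℝ)..1, cexp (I * s * u ^ 2)‖ ≤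
        Real.sqrt Real.pi * (8 / 3 * (Real.exp (-α ^ 2) / (2 * α ^ 2))) := by
  have hα0 : 0 < α := by linarith
  set t : ℕ → ℝ := midpointNode α with ht
  have ht0 : ∀ k, 0 < t k := midpointNode_pos hα0
  set F : ℕ → ℝ → ℂ := fun k u => 2 * (u : ℂ) * cexp (-((t k : ℂ) ^ 2 - s * I) * u ^ 2) with hF
  have hFcont : ∀ k, Continuous (F k) := fun k => by fun_prop
  have hFfac : ∀ k u, F k u = cexp (I * s * u ^ 2) *
      ((2 * u * Real.exp (-(t k ^ 2 * u ^ 2)) : ℝ) : ℂ) := by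
    intro k u
    simp only [hF]
    push_cast
    rw [mul_left_comm, ← Complex.exp_add]
    ring_nf
  have hnorm1 : ∀ u : ℝ, ‖cexp (I * s * u ^ 2)‖ = 1 := fun u => by
    rw [← norm_exp_ofReal_mul_I (s * u ^ 2)]; push_cast; ring_nf
  have hsum := hasSum_integral_of_summable_integral_norm (μ := volume.restrict (Set.Ioc (0 : ℝ) 1))
    (F := F) (fun k => ((hFcont k).intervalIntegrable 0 1).1) (by
      refine (summable_one_div_midpointNode_sq α).of_nonneg_of_le
        (fun k => integral_nonneg fun u => norm_nonneg _) fun k => ?_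
      refine le_trans (le_of_eq ?_) (integral_two_mul_mul_exp_neg_sq_le (pow_pos (ht0 k) 2))
      rw [intervalIntegral.integral_of_le zero_le_one]
      refine setIntegral_congr_fun measurableSet_Ioc fun u hu => ?_
      simp only [hFfac, norm_mul, hnorm1, one_mul, norm_real, Real.norm_eq_abs, neg_mul]
      rw [abs_two, abs_of_pos hu.1, Real.abs_exp, ht])
  simp_rw [← intervalIntegral.integral_of_le zero_le_one] at hsum
  refine ⟨_, hsum.congr_fun fun k => (integral_two_mul_mul_cexp_neg_sq
    (midpointNode_sq_sub_mul_I_ne_zero hα0 s k)).symm, ?_⟩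
  set G : ℝ → ℂ := fun u => ∑' k, F k u with hG
  have hGfac : ∀ u, G u = cexp (I * s * u ^ 2) *
      ((2 * u * ∑' k, Real.exp (-(t k ^ 2 * u ^ 2)) : ℝ) : ℂ) := by
    intro u
    simp only [hG, hFfac]
    rw [tsum_mul_left, ← ofReal_tsum, tsum_mul_left]
  have hE : IntervalIntegrable (fun u : ℝ => (Real.sqrt Real.pi : ℂ) * cexp (I * s * u ^ 2))
      volume 0 1 := Continuous.intervalIntegrable (by fun_prop) _ _
  set B : ℝ → ℝ := fun u => Real.sqrt Real.pi * (8 / 3 * Real.exp (-α ^ 2 * (3 - 2 * u)))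
  have hB : IntervalIntegrable B volume 0 1 := Continuous.intervalIntegrable (by fun_prop) _ _
  have hbound : ∀ u ∈ Set.Ioc (0 : ℝ) 1,
      ‖(Real.pi / α : ℂ) * G u - Real.sqrt Real.pi * cexp (I * s * u ^ 2)‖ ≤ B u := by
    intro u hu
    refine le_trans (le_of_eq ?_) (abs_midpoint_theta_sub_le hα hu.1 hu.2)
    rw [← Real.norm_eq_abs, ← norm_real, hGfac, ← one_mul ‖((_ : ℝ) : ℂ)‖, ← hnorm1 u, ← norm_mul]
    rw [ht]
    push_cast
    ring_nf
  have hmeas : AEStronglyMeasurable (fun u : ℝ => (Real.pi / α : ℂ) * G u -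
      Real.sqrt Real.pi * cexp (I * s * u ^ 2)) (volume.restrict (Set.uIoc 0 1)) := by
    have : Measurable G := Measurable.tsum fun k => (hFcont k).measurable
    exact (Measurable.aestronglyMeasurable (by fun_prop))
  have hdiff : IntervalIntegrable (fun u : ℝ => (Real.pi / α : ℂ) * G u -
      Real.sqrt Real.pi * cexp (I * s * u ^ 2)) volume 0 1 := by
    refine hB.mono_fun' hmeas ?_
    rw [Set.uIoc_of_le zero_le_one]
    exact (ae_restrict_mem measurableSet_Ioc).mono hbound
  have hGint : IntervalIntegrable (fun u : ℝ => (Real.pi / α : ℂ) * G u) volume 0 1 := by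
    simpa using hdiff.add hE
  rw [← intervalIntegral.integral_const_mul, ← intervalIntegral.integral_const_mul,
    ← intervalIntegral.integral_sub hGint hE]
  refine (intervalIntegral.norm_integral_le_of_norm_le zero_le_one (ae_of_all _ hbound) hB).trans ?_
  simp only [B, intervalIntegral.integral_const_mul]
  gcongr
  exact integral_exp_neg_sq_mul_le (by positivity)

open Complex in
theorem tanh_mul_one_sub_I {a : ℝ} (ha : a ≠ 0) :
    tanh (a * (1 - I) / 2) =
      (Real.sinh a - I * Real.sin a) / (Real.cos a + Real.cosh a : ℝ) := by
  have hpos : 0 < Real.cos a + Real.cosh a := by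
    linarith [Real.one_lt_cosh.2 ha, Real.neg_one_le_cos a]
  obtain ⟨b, rfl⟩ : ∃ b : ℝ, a = 2 * b := ⟨a / 2, by ring⟩
  have hb : ((2 * b : ℝ) : ℂ) * (1 - I) / 2 = b + (-b : ℂ) * I := by push_cast; ring
  have hsinh : sinh (b + (-b : ℂ) * I) = sinh b * cos b - I * (cosh b * sin b) := by
    rw [sinh_add, cosh_mul_I, sinh_mul_I, cos_neg, sin_neg]; ring
  have hcosh : cosh (b + (-b : ℂ) * I) = cosh b * cos b - I * (sinh b * sin b) := by
    rw [cosh_add, cosh_mul_I, sinh_mul_I, cos_neg, sin_neg]; ring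
  have hden : ((Real.cos (2 * b) + Real.cosh (2 * b) : ℝ) : ℂ) =
      2 * (cosh b ^ 2 + cos b ^ 2 - 1) := by
    push_cast
    rw [cos_two_mul, cosh_two_mul, sinh_sq]; ring
  have hprod : (cosh b * cos b - I * (sinh b * sin b)) * (cosh b * cos b + I * (sinh b * sin b)) =
      (cosh (b : ℂ) ^ 2 + cos (b : ℂ) ^ 2 - 1) := by
    linear_combination (-(sinh (b : ℂ) ^ 2 * sin (b : ℂ) ^ 2)) * I_sq +
      sinh (b : ℂ) ^ 2 * sin_sq (b : ℂ) + (1 - cos (b : ℂ) ^ 2) * sinh_sq (b : ℂ)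
  have hden0 : ((Real.cos (2 * b) + Real.cosh (2 * b) : ℝ) : ℂ) ≠ 0 := ofReal_ne_zero.2 hpos.ne'
  have hcosh0 : cosh b * cos b - I * (sinh b * sin b) ≠ 0 := by
    intro h
    rw [hden, ← hprod, h] at hden0
    simp at hden0
  rw [hb, tanh_eq_sinh_div_cosh, hsinh, hcosh, div_eq_div_iff hcosh0 hden0, hden]
  push_cast
  rw [sinh_two_mul, sin_two_mul]
  linear_combination (-2 * sinh (b : ℂ) * cos b * sin (b : ℂ) ^ 2) * I_sq +
    (2 * sinh (b : ℂ) * cos b) * sin_sq (b : ℂ) + (2 * I * cosh (b : ℂ) * sin b) * sinh_sq (b : ℂ)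

open Complex in
theorem hasSum_one_div_midpointNode {α x : ℝ} (hα : 0 < α) (hx : x ≠ 0) :
    HasSum (fun k : ℕ => x * Real.sqrt Real.pi / α *
        (1 / ((midpointNode α k : ℂ) ^ 2 - (Real.pi / 2 * x ^ 2 : ℝ) * I)))
      ((1 + I) / 2 * tanh ((Real.sqrt Real.pi * α * x : ℝ) * (1 - I) / 2)) := by
  set a : ℝ := Real.sqrt Real.pi * α * x with ha
  have hsp : 0 < Real.sqrt Real.pi := Real.sqrt_pos.2 Real.pi_pos
  have ha0 : a ≠ 0 := by positivity
  set y : ℂ := a * (1 - I) / 2 with hy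
  have hyre : y.re ≠ 0 := by simpa [hy] using ha0
  have hsummable : Summable fun k : ℕ => x * Real.sqrt Real.pi / α *
      (1 / ((midpointNode α k : ℂ) ^ 2 - (Real.pi / 2 * x ^ 2 : ℝ) * I)) := by
    refine Summable.mul_left _ (.of_norm_bounded (summable_one_div_midpointNode_sq α) fun k => ?_)
    rw [norm_div, norm_one]
    have := pow_pos (midpointNode_pos hα k) 2
    gcongr
    exact sq_le_norm_sq_sub_mul_I _ _
  rw [hsummable.hasSum_iff_tendsto_nat]
  convert (tendsto_sum_tanh hyre).const_mul ((1 + I) / 2) using 2 with n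
  rw [Finset.mul_sum]
  refine Finset.sum_congr rfl fun k _ => ?_
  have hαc : (α : ℂ) ≠ 0 := ofReal_ne_zero.2 hα.ne'
  have hsq : ((Real.sqrt Real.pi : ℝ) : ℂ) ^ 2 = Real.pi := by
    rw [← ofReal_pow, Real.sq_sqrt Real.pi_pos.le]
  have hden : ((k + 1 / 2) * Real.pi : ℂ) ^ 2 + y ^ 2 =
      α ^ 2 * ((midpointNode α k : ℂ) ^ 2 - (Real.pi / 2 * x ^ 2 : ℝ) * I) := by
    rw [hy, ha, midpointNode]
    push_cast
    field_simp
    linear_combination (α ^ 2 * x ^ 2 * (1 - I) ^ 2) * hsq + (α ^ 2 * x ^ 2 * Real.pi) * I_sq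
  have hnum : (1 + I) / 2 * (2 * y) = a := by
    rw [hy]; linear_combination (-(a : ℂ) / 2) * I_sq
  rw [hden, ← mul_div_assoc ((1 + I) / 2), hnum, ha]
  have := midpointNode_sq_sub_mul_I_ne_zero hα (Real.pi / 2 * x ^ 2) k
  push_cast at this ⊢
  field_simp

theorem A_sq (N : ℕ) : A N ^ 2 = ((N : ℝ) + 1 / 2) * Real.pi := by
  exact Real.sq_sqrt (show 0 ≤ ((N : ℝ) + 1 / 2) * Real.pi by positivity)

theorem A_pos (N : ℕ) : 0 < A N := by
  unfold A; positivity

theorem two_le_A {N : ℕ} (hN : 1 ≤ N) : 2 ≤ A N := by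
  refine Real.le_sqrt_of_sq_le ?_
  have : (1 : ℝ) ≤ N := by exact_mod_cast hN
  nlinarith [Real.pi_gt_three]

theorem tk_succ (N k : ℕ) : tk N (k + 1) = midpointNode (A N) k := by
  rw [tk, midpointNode, A]; push_cast; ring

theorem A_sq_add_le_midpointNode_sq (N j : ℕ) :
    A N ^ 2 + 2 * Real.pi * j ≤ midpointNode (A N) (j + N) ^ 2 := by
  have hA := A_pos N
  have hpi := Real.pi_pos
  have h : midpointNode (A N) (j + N) = A N + j * Real.pi / A N := by
    rw [midpointNode]; push_cast; field_simp; rw [A_sq]; ring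
  have h2 : midpointNode (A N) (j + N) ^ 2 =
      A N ^ 2 + 2 * Real.pi * j + (j * Real.pi / A N) ^ 2 := by
    rw [h]; field_simp; ring
  rw [h2]
  exact le_add_of_nonneg_right (sq_nonneg _)

open Complex in
theorem norm_cexp_neg_sq_sub_mul_I (t s : ℝ) :
    ‖cexp (-((t : ℂ) ^ 2 - s * I))‖ = Real.exp (-t ^ 2) := by
  rw [norm_exp]; simp [← ofReal_pow]

open Complex in
/-- The terms of the midpoint rule past the `N`-th are negligible. -/
theorem exists_hasSum_tail (N : ℕ) (s : ℝ) :
    ∃ R : ℂ, HasSum (fun j : ℕ => cexp (-((midpointNode (A N) (j + N) : ℂ) ^ 2 - s * I)) /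
        ((midpointNode (A N) (j + N) : ℂ) ^ 2 - s * I)) R ∧
      ‖R‖ ≤ Real.exp (-A N ^ 2) / A N ^ 2 * ((2 * Real.pi + 1) / (2 * Real.pi)) := by
  have hpi := Real.pi_pos
  have hA := A_pos N
  set r := Real.exp (-(2 * Real.pi)) with hr
  have hr1 : r < 1 := Real.exp_lt_one_iff.2 (by linarith)
  have hgeom := (hasSum_geometric_of_lt_one (Real.exp_pos _).le hr1).mul_left
    (Real.exp (-A N ^ 2) / A N ^ 2)
  have hbound : ∀ j : ℕ, ‖cexp (-((midpointNode (A N) (j + N) : ℂ) ^ 2 - s * I)) /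
      ((midpointNode (A N) (j + N) : ℂ) ^ 2 - s * I)‖ ≤
      Real.exp (-A N ^ 2) / A N ^ 2 * r ^ j := by
    intro j
    have h := A_sq_add_le_midpointNode_sq N j
    have hj : 0 ≤ 2 * Real.pi * j := by positivity
    rw [norm_div, norm_cexp_neg_sq_sub_mul_I, div_mul_eq_mul_div, hr, ← Real.exp_nat_mul,
      ← Real.exp_add]
    gcongr
    · linarith
    · exact le_trans (by linarith) (sq_le_norm_sq_sub_mul_I _ s)
  refine ⟨_, (Summable.of_norm_bounded hgeom.summable hbound).hasSum,
    (tsum_of_norm_bounded hgeom hbound).trans ?_⟩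
  gcongr
  have h1 : r * (2 * Real.pi + 1) ≤ 1 := by
    rw [hr, Real.exp_neg, inv_mul_le_one₀ (Real.exp_pos _)]
    exact Real.add_one_le_exp _
  rw [inv_eq_one_div, div_le_div_iff₀ (by linarith) (by positivity)]
  linarith

open Complex in
theorem sum_range_eq_aN_bN (N : ℕ) (s : ℝ) :
    ∑ k ∈ Finset.range N, cexp (-((midpointNode (A N) k : ℂ) ^ 2 - s * I)) /
        ((midpointNode (A N) k : ℂ) ^ 2 - s * I) =
      (Real.cos s + Real.sin s * I) * (bN N s + aN N s * I) := by
  have hI : ∀ f : ℕ → ℝ, ∑ k ∈ Finset.Icc 1 N, f k = ∑ k ∈ Finset.range N, f (k + 1) := by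
    intro f
    rw [Finset.range_eq_Ico, Finset.sum_Ico_add' f 0 N 1]
    rfl
  rw [aN, bN, hI, hI]
  push_cast
  rw [Finset.mul_sum, Finset.sum_mul, ← Finset.sum_add_distrib, Finset.mul_sum]
  refine Finset.sum_congr rfl fun k _ => ?_
  rw [tk_succ]
  have hne := midpointNode_sq_sub_mul_I_ne_zero (A_pos N) s k
  have ht := midpointNode_pos (A_pos N) k
  set t := midpointNode (A N) k
  have hne' : (s : ℂ) ^ 2 + (t : ℂ) ^ 4 ≠ 0 := by
    have : s ^ 2 + t ^ 4 ≠ 0 := by positivity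
    exact_mod_cast this
  rw [show -((t : ℂ) ^ 2 - s * I) = -(t : ℂ) ^ 2 + s * I by ring, Complex.exp_add, exp_mul_I]
  have hinv : ((t : ℂ) ^ 2 - s * I)⁻¹ = (t ^ 2 + s * I) / (s ^ 2 + t ^ 4) := by
    rw [inv_eq_one_div, div_eq_div_iff hne hne']
    linear_combination (s : ℂ) ^ 2 * I_sq
  rw [div_eq_mul_inv, hinv]
  ring

open Complex in
theorem fresnel_eq (x : ℝ) :
    (C x : ℂ) + S x * I = x * ∫ u in (0 : ℝ)..1, cexp (I * (Real.pi / 2 * x ^ 2 : ℝ) * u ^ 2) := by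
  have h := intervalIntegral.smul_integral_comp_mul_left (a := 0) (b := 1)
    (fun t : ℝ => cexp (I * (Real.pi / 2 * t ^ 2 : ℝ))) x
  rw [mul_zero, mul_one, real_smul] at h
  rw [C, S, ← intervalIntegral.integral_ofReal, ← intervalIntegral.integral_ofReal,
    ← intervalIntegral.integral_mul_const, ← intervalIntegral.integral_add
      (Continuous.intervalIntegrable (by fun_prop) _ _)
      (Continuous.intervalIntegrable (by fun_prop) _ _)]
  convert h.symm using 1
  · congr 1 with t
    rw [mul_comm I, exp_mul_I, ← ofReal_cos, ← ofReal_sin, mul_div_right_comm]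
  · push_cast; ring_nf

open Complex in
theorem CN_add_SN_mul_I (N : ℕ) {x : ℝ} (hx : x ≠ 0) :
    (CN N x : ℂ) + SN N x * I =
      (1 + I) / 2 * tanh ((Real.sqrt Real.pi * A N * x : ℝ) * (1 - I) / 2) -
        x * Real.sqrt Real.pi / A N *
          ∑ k ∈ Finset.range N,
            cexp (-((midpointNode (A N) k : ℂ) ^ 2 - (Real.pi / 2 * x ^ 2 : ℝ) * I)) /
              ((midpointNode (A N) k : ℂ) ^ 2 - (Real.pi / 2 * x ^ 2 : ℝ) * I) := by
  have hsp : 0 < Real.sqrt Real.pi := Real.sqrt_pos.2 Real.pi_pos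
  have hA := A_pos N
  rw [sum_range_eq_aN_bN, tanh_mul_one_sub_I (by positivity), CN, SN]
  push_cast
  ring_nf
  rw [I_sq]
  ring_nf

open Complex in
theorem fresnel_error_identity (x α : ℝ) (hα : 0 < α) (J T R Q : ℂ) :
    x * J - (((x * Real.sqrt Real.pi / α : ℝ) : ℂ) * (T + (R + Q)) -
      x * Real.sqrt Real.pi / α * Q) =
      -((x / Real.sqrt Real.pi : ℝ) : ℂ) * (Real.pi / α * T - Real.sqrt Real.pi * J) -
        ((x * Real.sqrt Real.pi / α : ℝ) : ℂ) * R := by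
  have hsp : 0 < Real.sqrt Real.pi := Real.sqrt_pos.2 Real.pi_pos
  have hspc : ((Real.sqrt Real.pi : ℝ) : ℂ) ≠ 0 := ofReal_ne_zero.2 hsp.ne'
  have hsq : ((Real.sqrt Real.pi : ℝ) : ℂ) ^ 2 = Real.pi := by
    rw [← ofReal_pow, Real.sq_sqrt Real.pi_pos.le]
  have hαc : (α : ℂ) ≠ 0 := ofReal_ne_zero.2 hα.ne'
  rw [← hsq]
  push_cast
  field_simp
  ring

open Complex in
theorem tanh_eq_mul_add {α x s : ℝ} (hα : 0 < α) (hx : x ≠ 0) (hs : s = Real.pi / 2 * x ^ 2)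
    (N : ℕ) {T R : ℂ}
    (hT : HasSum (fun k : ℕ => (1 - cexp (-((midpointNode α k : ℂ) ^ 2 - s * I))) /
        ((midpointNode α k : ℂ) ^ 2 - s * I)) T)
    (hR : HasSum (fun j : ℕ => cexp (-((midpointNode α (j + N) : ℂ) ^ 2 - s * I)) /
        ((midpointNode α (j + N) : ℂ) ^ 2 - s * I)) R) :
    (1 + I) / 2 * tanh ((Real.sqrt Real.pi * α * x : ℝ) * (1 - I) / 2) =
      ((x * Real.sqrt Real.pi / α : ℝ) : ℂ) * (T + (R + ∑ k ∈ Finset.range N,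
        cexp (-((midpointNode α k : ℂ) ^ 2 - s * I)) /
          ((midpointNode α k : ℂ) ^ 2 - s * I))) := by
  subst hs
  have hfull := (hasSum_nat_add_iff (f := fun k : ℕ =>
    cexp (-((midpointNode α k : ℂ) ^ 2 - (Real.pi / 2 * x ^ 2 : ℝ) * I)) /
      ((midpointNode α k : ℂ) ^ 2 - (Real.pi / 2 * x ^ 2 : ℝ) * I)) N).1 hR
  refine (hasSum_one_div_midpointNode hα hx).unique ?_
  refine ((hT.add hfull).mul_left ((x * Real.sqrt Real.pi / α : ℝ) : ℂ)).congr_fun fun k => ?_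
  rw [← add_div, sub_add_cancel, ofReal_div, ofReal_mul x]

open Complex in
theorem norm_fresnel_sub_le {N : ℕ} (hN : 1 ≤ N) {x : ℝ} (hx : x ≠ 0) :
    ‖((C x : ℂ) + S x * I) - (CN N x + SN N x * I)‖ ≤
      |x| * (8 / 3 * (Real.exp (-A N ^ 2) / (2 * A N ^ 2))) +
        |x| * Real.sqrt Real.pi / A N *
          (Real.exp (-A N ^ 2) / A N ^ 2 * ((2 * Real.pi + 1) / (2 * Real.pi))) := by
  have hA := A_pos N
  have hsp : 0 < Real.sqrt Real.pi := Real.sqrt_pos.2 Real.pi_pos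
  obtain ⟨T, hT, hTle⟩ := exists_hasSum_midpoint_fresnel (two_le_A hN) (Real.pi / 2 * x ^ 2)
  obtain ⟨R, hR, hRle⟩ := exists_hasSum_tail N (Real.pi / 2 * x ^ 2)
  rw [CN_add_SN_mul_I N hx, fresnel_eq, tanh_eq_mul_add hA hx rfl N hT hR,
    fresnel_error_identity x (A N) hA]
  refine (norm_sub_le _ _).trans (add_le_add ?_ ?_)
  · rw [norm_mul, norm_neg, norm_real, Real.norm_eq_abs, abs_div, abs_of_pos hsp]
    refine (mul_le_mul_of_nonneg_left hTle (by positivity)).trans (le_of_eq ?_)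
    field_simp
  · rw [norm_mul, norm_real, Real.norm_eq_abs, abs_div, abs_mul, abs_of_pos hsp, abs_of_pos hA]
    gcongr

theorem fresnel_error_le_ctilde {N : ℕ} (x : ℝ) :
    |x| * (8 / 3 * (Real.exp (-A N ^ 2) / (2 * A N ^ 2))) +
        |x| * Real.sqrt Real.pi / A N *
          (Real.exp (-A N ^ 2) / A N ^ 2 * ((2 * Real.pi + 1) / (2 * Real.pi))) ≤
      Real.sqrt Real.pi * ctilde N * |x| * Real.exp (-Real.pi * N) / (2 * (N : ℝ) + 1) := by
  have hA := A_pos N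
  have hpi := Real.pi_pos
  have hsp : 0 < Real.sqrt Real.pi := Real.sqrt_pos.2 hpi
  have hexp : Real.exp (-A N ^ 2) = Real.exp (-Real.pi * N) / Real.exp (Real.pi / 2) := by
    rw [A_sq, ← Real.exp_sub]; ring_nf
  have hden : 0 < 1 - Real.exp (-2 * A N ^ 2) := by
    have : Real.exp (-2 * A N ^ 2) < 1 := Real.exp_lt_one_iff.2 (by nlinarith [pow_pos hA 2])
    linarith
  have hle : 8 / (3 * (Real.pi * Real.sqrt Real.pi) * Real.exp (Real.pi / 2)) ≤
      8 / (3 * (Real.pi * Real.sqrt Real.pi) * Real.exp (Real.pi / 2) *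
        (1 - Real.exp (-2 * A N ^ 2))) := by
    refine div_le_div_of_nonneg_left (by norm_num) (by positivity) ?_
    exact mul_le_of_le_one_right (by positivity) (by linarith [Real.exp_pos (-2 * A N ^ 2)])
  calc _ = Real.sqrt Real.pi * (8 / (3 * (Real.pi * Real.sqrt Real.pi) * Real.exp (Real.pi / 2)) +
        (2 * Real.pi + 1) / (Real.pi ^ 2 * Real.exp (Real.pi / 2) * A N)) * |x| *
          Real.exp (-Real.pi * N) / (2 * (N : ℝ) + 1) := by
        rw [hexp, A_sq]
        have hN : (0 : ℝ) < 2 * N + 1 := by positivity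
        have hN' : (N : ℝ) + 1 / 2 = (2 * N + 1) / 2 := by ring
        rw [hN']
        field_simp
    _ ≤ _ := by
        unfold ctilde
        gcongr

theorem stmt_15 (N : ℕ) (hN : 1 ≤ N) (x : ℝ) (hx : |x| ≤ Real.sqrt ((N : ℝ) + 1 / 2)) :
    |C x - CN N x| ≤
        Real.sqrt Real.pi * ctilde N * |x| * Real.exp (-Real.pi * N) / (2 * (N : ℝ) + 1) ∧
      |S x - SN N x| ≤
        Real.sqrt Real.pi * ctilde N * |x| * Real.exp (-Real.pi * N) / (2 * (N : ℝ) + 1) := by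
  rcases eq_or_ne x 0 with rfl | hx0
  · simp [C, S, CN, SN]
  · have h := (norm_fresnel_sub_le hN hx0).trans (fresnel_error_le_ctilde x)
    refine ⟨le_trans ?_ h, le_trans ?_ h⟩
    · simpa using Complex.abs_re_le_norm
        (((C x : ℂ) + S x * Complex.I) - (CN N x + SN N x * Complex.I))
    · simpa using Complex.abs_im_le_norm
        (((C x : ℂ) + S x * Complex.I) - (CN N x + SN N x * Complex.I))

end
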